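/- (Expressive equivalence of μ↓dω-calculus and Büchi register automata) A data language L ⊆ (Σ×𝔻)^ω is recognized by some Büchi register automaton with k registers if and only if L = {w | w ⊨ σ} for some system of equations σ of the μ↓dω-calculus with k registers. -/

import Mathlib

namespace MuCal

/-- Basic formulas Φ_k over atomic propositions `At` and `k` registers. -/
inductive Phi (At : Type) (k : ℕ) : Type
  | tt : Phi At k
  | ff : Phi At k
  | pos : At → Phi At k
  | npos : At → Phi At k
  | up : Fin k → Phi At k
  | nup : Fin k → Phi At k
  | conj : Phi At k → Phi At k → Phi At k

/-- LTL↓dω formulas over variables `Var`. -/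
inductive Fml (At : Type) (k : ℕ) (Var : Type) : Type
  | var : Var → Fml At k Var
  | or : Fml At k Var → Fml At k Var → Fml At k Var
  | dX : Finset (Fin k) → Fml At k Var → Phi At k → Fml At k Var
  | tt : Fml At k Var

variable {At D Q Var : Type} {k : ℕ}

/-- θ[R←d] : update the registers in `R` to hold `d`. -/
def updA (θ : Fin k → D) (R : Finset (Fin k)) (d : D) : Fin k → D :=
  fun r => if r ∈ R then d else θ r

/-- Satisfaction of basic formulas: w,i,θ ⊨ φ. -/
def phiSat (w : ℕ → Set At × D) (i : ℕ) (θ : Fin k → D) : Phi At k → Prop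
  | Phi.tt => True
  | Phi.ff => False
  | Phi.pos p => p ∈ (w i).1
  | Phi.npos p => p ∉ (w i).1
  | Phi.up r => θ r = (w i).2
  | Phi.nup r => θ r ≠ (w i).2
  | Phi.conj φ₁ φ₂ => phiSat w i θ φ₁ ∧ phiSat w i θ φ₂

/-- Environments: each variable gets a set of 5-tuples (i,θ;j,θ′,x). -/
abbrev Env (D : Type) (k : ℕ) (Var : Type) : Type :=
  Var → Set (ℕ × (Fin k → D) × ℕ × (Fin k → D) × Var)

/-- The augmented relation w,i,θ,j,θ′,x ⊨_u ψ. -/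
def aSat (vtt : Var) (w : ℕ → Set At × D) (u : Env D k Var) :
    Fml At k Var → ℕ → (Fin k → D) → ℕ → (Fin k → D) → Var → Prop
  | Fml.var V, i, θ, j, θ', x => (i, θ, j, θ', x) ∈ u V
  | Fml.or ψ₁ ψ₂, i, θ, j, θ', x =>
      aSat vtt w u ψ₁ i θ j θ' x ∨ aSat vtt w u ψ₂ i θ j θ' x
  | Fml.dX R ψ φ, i, θ, j, θ', x =>
      i < j ∧ phiSat w i θ φ ∧ aSat vtt w u ψ (i + 1) (updA θ R (w i).2) j θ' x
  | Fml.tt, _, θ, _, θ', x => θ = θ' ∧ x = vtt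

/-- A system of equations: σ with a main variable, ω-variables, and V_tt. -/
structure EqSys (At : Type) (k : ℕ) (Var : Type) where
  σ : Var → Fml At k Var
  main : Var
  omega : Set Var
  vtt : Var

/-- Well-formedness conditions from Definition (system of equations):
V_tt ∈ Var_ω, σ(V_tt) = tt, and σ is injective on ω-variables. -/
def EqSys.WF (S : EqSys At k Var) : Prop :=
  S.vtt ∈ S.omega ∧ S.σ S.vtt = Fml.tt ∧
    ∀ V ∈ S.omega, ∀ V' : Var, S.σ V = S.σ V' → V = V'

/-- The variable updating mapping F_{σ,w}. -/
def Fmap (S : EqSys At k Var) (w : ℕ → Set At × D) (u : Env D k Var) : Env D k Var :=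
  fun V =>
    {t | aSat S.vtt w u (S.σ V) t.1 t.2.1 t.2.2.1 t.2.2.2.1 t.2.2.2.2} ∪
    {t | V ∈ S.omega ∧ ∃ (i : ℕ) (θ : Fin k → D), t = (i, θ, i, θ, V)}

/-- The least fixed point of F_{σ,w} (Knaster–Tarski form). -/
def lfpEnv (S : EqSys At k Var) (w : ℕ → Set At × D) : Env D k Var :=
  sInf {u | Fmap S w u ≤ u}

/-- w,i,θ ⊨_u V : an infinite chain of dependence through u exists. -/
def satVar (S : EqSys At k Var) (w : ℕ → Set At × D) (u : Env D k Var)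
    (i : ℕ) (θ : Fin k → D) (V : Var) : Prop :=
  ∃ (I : ℕ → ℕ) (Θ : ℕ → Fin k → D) (X : ℕ → Var),
    I 0 = i ∧ Θ 0 = θ ∧ X 0 = V ∧
    (∀ n, I n < I (n + 1)) ∧ (∀ n, X (n + 1) ∈ S.omega) ∧
    (∀ n, (I n, Θ n, I (n + 1), Θ (n + 1), X (n + 1)) ∈ u (X n))

/-- w ⊨ σ : w,1,⊥^k ⊨_{lfp(F_{σ,w})} V_main. -/
def sats (S : EqSys At k Var) (dbot : D) (w : ℕ → Set At × D) : Prop :=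
  satVar S w (lfpEnv S w) 1 (fun _ => dbot) S.main

/-- Normal form: every equation is V = V′ ∨ V″, V = ↓_R X V′ ∧ φ, or V = tt. -/
def InNormalForm (S : EqSys At k Var) : Prop :=
  ∀ V : Var,
    (∃ V₁ V₂ : Var, S.σ V = Fml.or (Fml.var V₁) (Fml.var V₂)) ∨
    (∃ (R : Finset (Fin k)) (V₁ : Var) (φ : Phi At k), S.σ V = Fml.dX R (Fml.var V₁) φ) ∨
    S.σ V = Fml.tt

/-- `IsDisj ψ s` : ψ is an iterated disjunction of exactly the variables in `s`. -/
inductive IsDisj {At : Type} {k : ℕ} {Var : Type} : Fml At k Var → Set Var → Prop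
  | var (V : Var) : IsDisj (Fml.var V) {V}
  | or {ψ₁ ψ₂ : Fml At k Var} {s₁ s₂ : Set Var} :
      IsDisj ψ₁ s₁ → IsDisj ψ₂ s₂ → IsDisj (Fml.or ψ₁ ψ₂) (s₁ ∪ s₂)

/-- A Büchi register automaton with k registers; `none` as guard means ε. -/
structure BRA (At : Type) (k : ℕ) (Q : Type) where
  q0 : Q
  δ : Set (Q × Option (Phi At k) × Finset (Fin k) × Q)
  acc : Set Q

/-- One transition step on IDs (q,θ,i), where i is the current position. -/
inductive BStep (A : BRA At k Q) (w : ℕ → Set At × D) :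
    Q × (Fin k → D) × ℕ → Q × (Fin k → D) × ℕ → Prop
  | rule {q q' : Q} {φ : Phi At k} {R : Finset (Fin k)} {θ : Fin k → D} {i : ℕ} :
      (q, some φ, R, q') ∈ A.δ → phiSat w i θ φ →
      BStep A w (q, θ, i) (q', updA θ R (w i).2, i + 1)
  | eps {q q' : Q} {θ : Fin k → D} {i : ℕ} :
      (q, none, (∅ : Finset (Fin k)), q') ∈ A.δ →
      BStep A w (q, θ, i) (q', θ, i)

/-- ⊢* : reflexive-transitive closure of the step relation. -/
def BSteps (A : BRA At k Q) (w : ℕ → Set At × D) :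
    Q × (Fin k → D) × ℕ → Q × (Fin k → D) × ℕ → Prop :=
  Relation.ReflTransGen (BStep A w)

/-- Büchi acceptance: some accepting state is visited at infinitely many,
strictly increasing positions, starting from (q₀, ⊥^k) at position 1. -/
def accepts (A : BRA At k Q) (dbot : D) (w : ℕ → Set At × D) : Prop :=
  ∃ qF ∈ A.acc, ∃ (I : ℕ → ℕ) (Θ : ℕ → Fin k → D),
    1 ≤ I 0 ∧ (∀ n, I n < I (n + 1)) ∧
    BSteps A w (A.q0, fun _ => dbot, 1) (qF, Θ 0, I 0) ∧
    ∀ n, BSteps A w (qF, Θ n, I n) (qF, Θ (n + 1), I (n + 1))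

def lang (A : BRA At k Q) (dbot : D) : Set (ℕ → Set At × D) :=
  {w | accepts A dbot w}

/-- The BRA constructed from a normal-form system σ (Theorem μ↓dω → BRA):
states are the formulas σ(V), initial state σ(V_t), accepting states σ(V_ω). -/
def toBRA (S : EqSys At k Var) : BRA At k (Fml At k Var) where
  q0 := S.σ S.main
  δ :=
    {t | t = (Fml.tt, some Phi.tt, (∅ : Finset (Fin k)), Fml.tt)} ∪
    {t | ∃ V V₁ V₂ : Var, S.σ V = Fml.or (Fml.var V₁) (Fml.var V₂) ∧
          (t = (S.σ V, none, (∅ : Finset (Fin k)), S.σ V₁) ∨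
           t = (S.σ V, none, (∅ : Finset (Fin k)), S.σ V₂))} ∪
    {t | ∃ (V : Var) (R : Finset (Fin k)) (V₁ : Var) (φ : Phi At k),
          S.σ V = Fml.dX R (Fml.var V₁) φ ∧ t = (S.σ V, some φ, R, S.σ V₁)}
  acc := S.σ '' S.omega

/-- Variables of the system constructed from a BRA:
V_q for q ∈ Q, V_r for r ∈ δ, and V_tt. -/
abbrev RVar (A : BRA At k Q) : Type := Q ⊕ ({r // r ∈ A.δ} ⊕ Unit)

/-- The BRA 𝒜′ obtained by applying the μ↓dω-to-BRA construction (with m-ary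
disjunction states) to the system σ constructed from 𝒜. -/
def roundBRA (A : BRA At k Q) (S : EqSys At k (RVar A)) :
    BRA At k (Fml At k (RVar A)) where
  q0 := S.σ (Sum.inl A.q0)
  δ :=
    {t | t = (Fml.tt, some Phi.tt, (∅ : Finset (Fin k)), Fml.tt)} ∪
    {t | ∃ (q : Q) (r : {r // r ∈ A.δ}), r.val.1 = q ∧
          t = (S.σ (Sum.inl q), none, (∅ : Finset (Fin k)), S.σ (Sum.inr (Sum.inl r)))} ∪
    {t | ∃ r : {r // r ∈ A.δ},
          t = (S.σ (Sum.inr (Sum.inl r)), r.val.2.1, r.val.2.2.1,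
               S.σ (Sum.inl r.val.2.2.2))}
  acc := (fun q : Q => S.σ (Sum.inl q)) '' A.acc ∪ {Fml.tt}

end MuCal

open MuCal

namespace MuCal

variable {At D Q Var : Type} {k : ℕ}

section Automata

theorem BSteps.le {A : BRA At k Q} {w : ℕ → Set At × D} {s t : Q × (Fin k → D) × ℕ}
    (h : BSteps A w s t) : s.2.2 ≤ t.2.2 := by
  induction h with
  | refl => exact le_rfl
  | tail _ hstep ih =>
    cases hstep with
    | rule => exact Nat.le_succ_of_le ih
    | eps => exact ih

/-- Büchi acceptance does not require the same accepting state to be visited each time,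
provided that there are only finitely many accepting states. -/
theorem accepts_iff_exists_chain (A : BRA At k Q) (hacc : A.acc.Finite) (dbot : D)
    (w : ℕ → Set At × D) :
    accepts A dbot w ↔ ∃ (I : ℕ → ℕ) (Θ : ℕ → Fin k → D) (X : ℕ → Q),
      I 0 = 1 ∧ Θ 0 = (fun _ => dbot) ∧ X 0 = A.q0 ∧ (∀ n, I n < I (n + 1)) ∧
      (∀ n, X (n + 1) ∈ A.acc) ∧
      ∀ n, BSteps A w (X n, Θ n, I n) (X (n + 1), Θ (n + 1), I (n + 1)) := by
  constructor
  · rintro ⟨q, hq, I, Θ, hI0, hI, hfirst, hsteps⟩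
    refine ⟨fun n => Nat.casesOn n 1 fun m => I (m + 1),
      fun n => Nat.casesOn n (fun _ => dbot) fun m => Θ (m + 1),
      fun n => Nat.casesOn n A.q0 fun _ => q, rfl, rfl, rfl, ?_, fun _ => hq, ?_⟩
    · rintro (_ | n)
      · exact hI0.trans_lt (hI 0)
      · exact hI (n + 1)
    · rintro (_ | n)
      · exact hfirst.trans (hsteps 0)
      · exact hsteps (n + 1)
  · rintro ⟨I, Θ, X, hI0, hΘ0, hX0, hI, hacc', hsteps⟩
    have : Finite A.acc := hacc
    have hmono : StrictMono I := strictMono_nat_of_lt_succ hI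
    have hpath : ∀ m n, m ≤ n → BSteps A w (X m, Θ m, I m) (X n, Θ n, I n) := by
      intro m n hmn
      induction n, hmn using Nat.le_induction with
      | base => exact Relation.ReflTransGen.refl
      | succ n _ ih => exact ih.trans (hsteps n)
    obtain ⟨q, hq⟩ := Finite.exists_infinite_fiber fun n => (⟨X (n + 1), hacc' n⟩ : A.acc)
    obtain ⟨g, hg, hgq⟩ := Filter.extraction_of_frequently_atTop
      (Nat.frequently_atTop_iff_infinite.2 (Set.infinite_coe_iff.1 hq))
    have hX : ∀ n, X (g n + 1) = q.1 := fun n => congrArg Subtype.val (hgq n)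
    refine ⟨q.1, q.2, fun n => I (g n + 1), fun n => Θ (g n + 1), ?_, ?_, ?_, ?_⟩
    · exact hI0 ▸ hmono.monotone (Nat.zero_le _)
    · exact fun n => hmono (Nat.succ_lt_succ (hg n.lt_succ_self))
    · have := hpath 0 (g 0 + 1) (Nat.zero_le _)
      rwa [hX, hI0, hΘ0, hX0] at this
    · intro n
      have := hpath (g n + 1) (g (n + 1) + 1) (Nat.succ_le_succ (hg n.lt_succ_self).le)
      rwa [hX, hX] at this

/-- Restriction of an automaton to a set of states containing the initial one. -/
def BRA.restrict (A : BRA At k Q) (C : Set Q) (h0 : A.q0 ∈ C) : BRA At k C where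
  q0 := ⟨A.q0, h0⟩
  δ := {t | (t.1.1, t.2.1, t.2.2.1, t.2.2.2.1) ∈ A.δ}
  acc := {q | q.1 ∈ A.acc}

theorem BSteps_restrict_iff {A : BRA At k Q} {C : Set Q} {h0 : A.q0 ∈ C}
    (hC : ∀ q g R q', (q, g, R, q') ∈ A.δ → q ∈ C → q' ∈ C) {w : ℕ → Set At × D}
    {p q : C} {θ θ' : Fin k → D} {i j : ℕ} :
    BSteps (A.restrict C h0) w (p, θ, i) (q, θ', j) ↔ BSteps A w (p.1, θ, i) (q.1, θ', j) := by
  constructor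
  · intro h
    refine Relation.ReflTransGen.lift (fun s : C × (Fin k → D) × ℕ => (s.1.1, s.2)) ?_ _ _ h
    intro s t hst
    cases hst with
    | rule hδ hφ => exact .rule hδ hφ
    | eps hδ => exact .eps hδ
  · intro h
    have key : ∀ t, BSteps A w (p.1, θ, i) t → ∃ ht : t.1 ∈ C,
        BSteps (A.restrict C h0) w (p, θ, i) (⟨t.1, ht⟩, t.2) := by
      intro t ht
      induction ht with
      | refl => exact ⟨p.2, Relation.ReflTransGen.refl⟩
      | tail _ hstep ih =>
        obtain ⟨hb, ih⟩ := ih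
        cases hstep with
        | rule hδ hφ =>
          exact ⟨hC _ _ _ _ hδ hb, ih.tail (.rule (A := A.restrict C h0) (q := ⟨_, hb⟩)
            (q' := ⟨_, hC _ _ _ _ hδ hb⟩) hδ hφ)⟩
        | eps hδ =>
          exact ⟨hC _ _ _ _ hδ hb, ih.tail (.eps (A := A.restrict C h0) (q := ⟨_, hb⟩)
            (q' := ⟨_, hC _ _ _ _ hδ hb⟩) hδ)⟩
    exact (key _ h).2

theorem lang_restrict {A : BRA At k Q} {C : Set Q} {h0 : A.q0 ∈ C}
    (hC : ∀ q g R q', (q, g, R, q') ∈ A.δ → q ∈ C → q' ∈ C) (hacc : A.acc ⊆ C) (dbot : D) :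
    lang (A.restrict C h0) dbot = lang A dbot := by
  ext w
  constructor
  · rintro ⟨q, hq, I, Θ, hI0, hI, hfirst, hsteps⟩
    exact ⟨q.1, hq, I, Θ, hI0, hI, (BSteps_restrict_iff hC).1 hfirst,
      fun n => (BSteps_restrict_iff hC).1 (hsteps n)⟩
  · rintro ⟨q, hq, I, Θ, hI0, hI, hfirst, hsteps⟩
    exact ⟨⟨q, hacc hq⟩, hq, I, Θ, hI0, hI, (BSteps_restrict_iff hC).2 hfirst,
      fun n => (BSteps_restrict_iff hC).2 (hsteps n)⟩

end Automata

section LeastFixedPoint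

theorem aSat_mono (vtt : Var) (w : ℕ → Set At × D) {u v : Env D k Var} (h : u ≤ v)
    (ψ : Fml At k Var) {i θ j θ' x} (hu : aSat vtt w u ψ i θ j θ' x) :
    aSat vtt w v ψ i θ j θ' x := by
  induction ψ generalizing i θ with
  | var V => exact h V hu
  | or ψ₁ ψ₂ ih₁ ih₂ => exact hu.imp ih₁ ih₂
  | dX R ψ φ ih => exact ⟨hu.1, hu.2.1, ih hu.2.2⟩
  | tt => exact hu

theorem Fmap_mono (S : EqSys At k Var) (w : ℕ → Set At × D) : Monotone (Fmap S w) :=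
  fun _ _ h V => Set.union_subset_union_left _ fun _ ht => aSat_mono _ _ h (S.σ V) ht

theorem Fmap_lfpEnv_le (S : EqSys At k Var) (w : ℕ → Set At × D) :
    Fmap S w (lfpEnv S w) ≤ lfpEnv S w :=
  le_sInf fun _ hu => (Fmap_mono S w (sInf_le hu)).trans hu

theorem lfpEnv_le {S : EqSys At k Var} {w : ℕ → Set At × D} {u : Env D k Var}
    (h : Fmap S w u ≤ u) : lfpEnv S w ≤ u :=
  sInf_le h

theorem mem_lfpEnv_of_aSat {S : EqSys At k Var} {w : ℕ → Set At × D} {V : Var} {i θ j θ' x}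
    (h : aSat S.vtt w (lfpEnv S w) (S.σ V) i θ j θ' x) : (i, θ, j, θ', x) ∈ lfpEnv S w V :=
  Fmap_lfpEnv_le S w V (Or.inl h)

theorem mem_lfpEnv_of_mem_omega {S : EqSys At k Var} {w : ℕ → Set At × D} {V : Var}
    (h : V ∈ S.omega) (i : ℕ) (θ : Fin k → D) : (i, θ, i, θ, V) ∈ lfpEnv S w V :=
  Fmap_lfpEnv_le S w V (Or.inr ⟨h, i, θ, rfl⟩)

end LeastFixedPoint

section SystemToAutomaton

/-- Transition rules of the automaton whose states are formulas. -/
inductive FmlRule (S : EqSys At k Var) :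
    Fml At k Var → Option (Phi At k) → Finset (Fin k) → Fml At k Var → Prop
  | expand (V : Var) : FmlRule S (Fml.var V) none ∅ (S.σ V)
  | left (ψ₁ ψ₂ : Fml At k Var) : FmlRule S (Fml.or ψ₁ ψ₂) none ∅ ψ₁
  | right (ψ₁ ψ₂ : Fml At k Var) : FmlRule S (Fml.or ψ₁ ψ₂) none ∅ ψ₂
  | next (R : Finset (Fin k)) (ψ : Fml At k Var) (φ : Phi At k) :
      FmlRule S (Fml.dX R ψ φ) (some φ) R ψ
  | loop : FmlRule S Fml.tt (some Phi.tt) ∅ Fml.tt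
  | verum : FmlRule S Fml.tt none ∅ (Fml.var S.vtt)

/-- The automaton with formulas as states, accepting at the ω-variables. -/
def fmlBRA (S : EqSys At k Var) : BRA At k (Fml At k Var) where
  q0 := Fml.var S.main
  δ := {t | FmlRule S t.1 t.2.1 t.2.2.1 t.2.2.2}
  acc := Fml.var '' S.omega

theorem mem_fmlBRA_δ {S : EqSys At k Var} {ψ χ : Fml At k Var} {g R} :
    (ψ, g, R, χ) ∈ (fmlBRA S).δ ↔ FmlRule S ψ g R χ :=
  Iff.rfl

/-- The set of subformulas of a formula. -/
def Fml.sub : Fml At k Var → Set (Fml At k Var)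
  | Fml.var V => {Fml.var V}
  | Fml.or ψ₁ ψ₂ => insert (Fml.or ψ₁ ψ₂) (ψ₁.sub ∪ ψ₂.sub)
  | Fml.dX R ψ φ => insert (Fml.dX R ψ φ) ψ.sub
  | Fml.tt => {Fml.tt}

theorem Fml.self_mem_sub (ψ : Fml At k Var) : ψ ∈ ψ.sub := by
  cases ψ <;> simp [Fml.sub]

theorem Fml.finite_sub (ψ : Fml At k Var) : ψ.sub.Finite := by
  induction ψ with
  | var V => exact Set.finite_singleton _
  | or ψ₁ ψ₂ ih₁ ih₂ => exact (ih₁.union ih₂).insert _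
  | dX R ψ φ ih => exact ih.insert _
  | tt => exact Set.finite_singleton _

theorem Fml.sub_subset {χ ψ : Fml At k Var} (h : χ ∈ ψ.sub) : χ.sub ⊆ ψ.sub := by
  induction ψ with
  | var V => rw [Set.mem_singleton_iff.1 h]
  | or ψ₁ ψ₂ ih₁ ih₂ =>
    rcases h with rfl | h | h
    · exact subset_rfl
    · exact (ih₁ h).trans (Set.subset_union_left.trans (Set.subset_insert _ _))
    · exact (ih₂ h).trans (Set.subset_union_right.trans (Set.subset_insert _ _))
  | dX R ψ φ ih =>
    rcases h with rfl | h
    · exact subset_rfl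
    · exact (ih h).trans (Set.subset_insert _ _)
  | tt => rw [Set.mem_singleton_iff.1 h]

/-- The states reachable in `fmlBRA`: variables and subformulas of right-hand sides. -/
def fmlStates (S : EqSys At k Var) : Set (Fml At k Var) :=
  Set.range Fml.var ∪ ⋃ V, (S.σ V).sub

theorem finite_fmlStates [Finite Var] (S : EqSys At k Var) : (fmlStates S).Finite :=
  (Set.finite_range _).union (Set.finite_iUnion fun V => (S.σ V).finite_sub)

theorem sub_subset_fmlStates {S : EqSys At k Var} {ψ : Fml At k Var} (h : ψ ∈ fmlStates S) :
    ψ.sub ⊆ fmlStates S := by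
  rcases h with ⟨V, rfl⟩ | h
  · exact Set.singleton_subset_iff.2 (Or.inl ⟨V, rfl⟩)
  · obtain ⟨V, hV⟩ := Set.mem_iUnion.1 h
    exact (Fml.sub_subset hV).trans ((Set.subset_iUnion (fun V => (S.σ V).sub) V).trans
      Set.subset_union_right)

theorem fmlStates_closed {S : EqSys At k Var} {ψ χ : Fml At k Var} {g R}
    (h : FmlRule S ψ g R χ) (hψ : ψ ∈ fmlStates S) : χ ∈ fmlStates S := by
  cases h with
  | expand V => exact Or.inr (Set.mem_iUnion.2 ⟨V, (S.σ V).self_mem_sub⟩)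
  | left ψ₁ ψ₂ =>
    exact sub_subset_fmlStates hψ (Set.mem_insert_of_mem _ (Or.inl χ.self_mem_sub))
  | right ψ₁ ψ₂ =>
    exact sub_subset_fmlStates hψ (Set.mem_insert_of_mem _ (Or.inr χ.self_mem_sub))
  | next R ψ φ => exact sub_subset_fmlStates hψ (Set.mem_insert_of_mem _ χ.self_mem_sub)
  | loop => exact hψ
  | verum => exact Or.inl ⟨_, rfl⟩

theorem updA_empty (θ : Fin k → D) (d : D) : updA θ ∅ d = θ := by
  funext r
  simp [updA]

theorem fmlBRA_BSteps_tt (S : EqSys At k Var) (w : ℕ → Set At × D) (θ : Fin k → D) {i j : ℕ}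
    (h : i ≤ j) : BSteps (fmlBRA S) w (Fml.tt, θ, i) (Fml.tt, θ, j) := by
  induction j, h using Nat.le_induction with
  | base => exact Relation.ReflTransGen.refl
  | succ j _ ih =>
    have hstep : BStep (fmlBRA S) w (Fml.tt, θ, j) (Fml.tt, updA θ ∅ (w j).2, j + 1) :=
      .rule (A := fmlBRA S) (φ := Phi.tt) FmlRule.loop trivial
    rw [updA_empty] at hstep
    exact ih.tail hstep

theorem fmlBRA_BSteps_of_mem_lfpEnv {S : EqSys At k Var} {w : ℕ → Set At × D} {V x : Var}
    {i j : ℕ} {θ θ' : Fin k → D} (h : (i, θ, j, θ', x) ∈ lfpEnv S w V) (hij : i ≤ j) :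
    BSteps (fmlBRA S) w (Fml.var V, θ, i) (Fml.var x, θ', j) := by
  let u : Env D k Var := fun V => {t | t.1 ≤ t.2.2.1 →
    BSteps (fmlBRA S) w (Fml.var V, t.2.1, t.1) (Fml.var t.2.2.2.2, t.2.2.2.1, t.2.2.1)}
  have key : ∀ (ψ : Fml At k Var) {i θ j θ' x}, aSat S.vtt w u ψ i θ j θ' x → i ≤ j →
      BSteps (fmlBRA S) w (ψ, θ, i) (Fml.var x, θ', j) := by
    intro ψ
    induction ψ with
    | var V => exact fun h hij => h hij
    | or ψ₁ ψ₂ ih₁ ih₂ =>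
      intro i θ j θ' x h hij
      rcases h with h | h
      · exact .head (.eps (FmlRule.left ψ₁ ψ₂)) (ih₁ h hij)
      · exact .head (.eps (FmlRule.right ψ₁ ψ₂)) (ih₂ h hij)
    | dX R ψ φ ih =>
      rintro i θ j θ' x ⟨hlt, hφ, h⟩ -
      exact .head (.rule (FmlRule.next R ψ φ) hφ) (ih h hlt)
    | tt =>
      rintro i θ j θ' x ⟨rfl, rfl⟩ hij
      exact (fmlBRA_BSteps_tt S w θ hij).tail (.eps FmlRule.verum)
  refine lfpEnv_le (u := u) ?_ V h hij
  rintro V ⟨i, θ, j, θ', x⟩ (h | ⟨-, i', θ₀, h⟩)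
  · exact fun hij => .head (.eps (FmlRule.expand V)) (key _ h hij)
  · simp only [Prod.mk.injEq] at h
    obtain ⟨rfl, rfl, rfl, rfl, rfl⟩ := h
    exact fun _ => .refl

theorem aSat_lfpEnv_of_fmlBRA_BSteps {S : EqSys At k Var} (htt : S.σ S.vtt = Fml.tt)
    {w : ℕ → Set At × D} {ψ : Fml At k Var} {x : Var} {i j : ℕ} {θ θ' : Fin k → D}
    (hx : x ∈ S.omega) (h : BSteps (fmlBRA S) w (ψ, θ, i) (Fml.var x, θ', j)) :
    aSat S.vtt w (lfpEnv S w) ψ i θ j θ' x := by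
  suffices key : ∀ s, BSteps (fmlBRA S) w s (Fml.var x, θ', j) →
      aSat S.vtt w (lfpEnv S w) s.1 s.2.2 s.2.1 j θ' x from key _ h
  intro s hs
  induction hs using Relation.ReflTransGen.head_induction_on with
  | refl => exact mem_lfpEnv_of_mem_omega hx j θ'
  | head hstep hrest ih =>
    cases hstep with
    | rule hδ hφ =>
      rw [mem_fmlBRA_δ] at hδ
      cases hδ with
      | next R ψ φ => exact ⟨BSteps.le hrest, hφ, ih⟩
      | loop =>
        rw [updA_empty] at ih
        exact ih
    | eps hδ =>
      rw [mem_fmlBRA_δ] at hδ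
      cases hδ with
      | expand V => exact mem_lfpEnv_of_aSat ih
      | left => exact Or.inl ih
      | right => exact Or.inr ih
      | verum =>
        refine lfpEnv_le
          (u := fun V => {t | V = S.vtt → t.2.1 = t.2.2.2.1 ∧ t.2.2.2.2 = S.vtt}) ?_ _ ih rfl
        rintro _ t (ht | ⟨-, i', θ₀, rfl⟩) rfl
        · simpa [htt, aSat] using ht
        · exact ⟨rfl, rfl⟩

theorem accepts_fmlBRA_iff [Finite Var] {S : EqSys At k Var} (htt : S.σ S.vtt = Fml.tt)
    (dbot : D) (w : ℕ → Set At × D) : accepts (fmlBRA S) dbot w ↔ sats S dbot w := by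
  rw [accepts_iff_exists_chain _ (Set.toFinite S.omega |>.image _)]
  constructor
  · rintro ⟨I, Θ, X, hI0, hΘ0, hX0, hI, hacc, hsteps⟩
    have hvar : ∀ n, ∃ V, Fml.var V = X n := by
      rintro (_ | n)
      · exact ⟨S.main, hX0.symm⟩
      · exact (hacc n).imp fun _ h => h.2
    choose Y hY using hvar
    have homega : ∀ n, Y (n + 1) ∈ S.omega := by
      intro n
      obtain ⟨V, hV, hVX⟩ := hacc n
      rw [← hY, Fml.var.injEq] at hVX
      exact hVX ▸ hV
    refine ⟨I, Θ, Y, hI0, hΘ0, ?_, hI, homega, fun n => ?_⟩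
    · rw [← hY] at hX0
      exact Fml.var.inj hX0
    · have := hsteps n
      rw [← hY, ← hY] at this
      exact aSat_lfpEnv_of_fmlBRA_BSteps htt (homega n) this
  · rintro ⟨I, Θ, X, hI0, hΘ0, hX0, hI, homega, hmem⟩
    exact ⟨I, Θ, fun n => Fml.var (X n), hI0, hΘ0, congrArg Fml.var hX0, hI,
      fun n => ⟨_, homega n, rfl⟩, fun n => fmlBRA_BSteps_of_mem_lfpEnv (hmem n) (hI n).le⟩

theorem exists_BRA_of_EqSys [Finite Var] (S : EqSys At k Var) (htt : S.σ S.vtt = Fml.tt)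
    (dbot : D) : ∃ (Q : Type) (_ : Finite Q) (A : BRA At k Q),
      lang A dbot = {w : ℕ → Set At × D | sats S dbot w} := by
  have h0 : (fmlBRA S).q0 ∈ fmlStates S := Or.inl ⟨_, rfl⟩
  refine ⟨fmlStates S, finite_fmlStates S, (fmlBRA S).restrict _ h0, ?_⟩
  rw [lang_restrict (fun _ _ _ _ h hq => fmlStates_closed (mem_fmlBRA_δ.1 h) hq)]
  · ext w
    exact accepts_fmlBRA_iff htt dbot w
  · rintro _ ⟨V, -, rfl⟩
    exact Or.inl ⟨V, rfl⟩

end SystemToAutomaton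

section AutomatonToSystem

/-- The set of pairs of a letter and a set of registers (those holding the current data value)
satisfying a basic formula. -/
def Phi.models : Phi At k → Set (Set At × Set (Fin k))
  | Phi.tt => Set.univ
  | Phi.ff => ∅
  | Phi.pos p => {m | p ∈ m.1}
  | Phi.npos p => {m | p ∉ m.1}
  | Phi.up r => {m | r ∈ m.2}
  | Phi.nup r => {m | r ∉ m.2}
  | Phi.conj φ₁ φ₂ => φ₁.models ∩ φ₂.models

theorem phiSat_iff_mem_models (w : ℕ → Set At × D) (i : ℕ) (θ : Fin k → D) (φ : Phi At k) :
    phiSat w i θ φ ↔ ((w i).1, {r | θ r = (w i).2}) ∈ φ.models := by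
  induction φ with
  | conj φ₁ φ₂ ih₁ ih₂ => exact and_congr ih₁ ih₂
  | _ => simp [phiSat, Phi.models]

/-- Every automaton has the same transition relation as one with finitely many rules. -/
theorem exists_finite_rules [Finite At] [Finite Q] (A : BRA At k Q) :
    ∃ T : Set (Q × Option (Phi At k) × Finset (Fin k) × Q), T.Finite ∧
      ∀ (D : Type) (w : ℕ → Set At × D),
        BStep (⟨A.q0, T, A.acc⟩ : BRA At k Q) w = BStep A w := by
  let f : Q × Option (Phi At k) × Finset (Fin k) × Q →
      Q × Option (Set (Set At × Set (Fin k))) × Finset (Fin k) × Q :=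
    fun t => (t.1, t.2.1.map Phi.models, t.2.2)
  obtain ⟨T, hT, hbij⟩ := Set.exists_subset_bijOn A.δ f
  refine ⟨T, hbij.finite_iff_finite.2 (Set.toFinite _), fun D w => ?_⟩
  funext s t
  refine propext ⟨fun h => ?_, fun h => ?_⟩
  · cases h with
    | rule hδ hφ => exact .rule (hT hδ) hφ
    | eps hδ => exact .eps (hT hδ)
  · cases h with
    | @rule q q' φ R θ i hδ hφ =>
      obtain ⟨⟨p, g, R', p'⟩, hmem, heq⟩ := hbij.surjOn ⟨_, hδ, rfl⟩
      simp only [f, Prod.mk.injEq, Option.map_some, Option.map_eq_some_iff] at heq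
      obtain ⟨rfl, ⟨φ', rfl, hφ'⟩, rfl, rfl⟩ := heq
      refine .rule hmem ?_
      rwa [phiSat_iff_mem_models, hφ', ← phiSat_iff_mem_models]
    | eps hδ =>
      obtain ⟨⟨p, g, R', p'⟩, hmem, heq⟩ := hbij.surjOn ⟨_, hδ, rfl⟩
      simp only [f, Prod.mk.injEq, Option.map_none, Option.map_eq_none_iff] at heq
      obtain ⟨rfl, rfl, rfl, rfl⟩ := heq
      exact .eps hmem

theorem exists_finite_disjunction {s : Set (Fml At k Var)} (hs : s.Finite) (hne : s.Nonempty) :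
    ∃ ψ : Fml At k Var, ∀ (D : Type) (vtt : Var) (w : ℕ → Set At × D) (u : Env D k Var)
      (i : ℕ) (θ : Fin k → D) (j : ℕ) (θ' : Fin k → D) (x : Var),
      aSat vtt w u ψ i θ j θ' x ↔ ∃ χ ∈ s, aSat vtt w u χ i θ j θ' x := by
  induction s, hs using Set.Finite.induction_on with
  | empty => exact absurd hne Set.not_nonempty_empty
  | @insert a s _ _ ih =>
    rcases s.eq_empty_or_nonempty with rfl | hs
    · exact ⟨a, by simp⟩
    · obtain ⟨ψ, hψ⟩ := ih hs
      exact ⟨Fml.or a ψ, by simp [aSat, hψ]⟩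

/-- The formula describing a transition rule; ε-rules that assign registers are idle. -/
def ruleFml (t : Q × Option (Phi At k) × Finset (Fin k) × Q) : Fml At k (Option Q) :=
  match t with
  | (q, none, R, q') => Fml.var (some (if R = ∅ then q' else q))
  | (_, some φ, R, q') => Fml.dX R (Fml.var (some q')) φ

/-- The right-hand sides for a state: an idle step or one of its rules. -/
def stateFmls (A : BRA At k Q) (q : Q) : Set (Fml At k (Option Q)) :=
  insert (Fml.var (some q)) (ruleFml '' {t | t ∈ A.δ ∧ t.1 = q})

theorem exists_stateFml {A : BRA At k Q} (hδ : A.δ.Finite) (q : Q) :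
    ∃ ψ : Fml At k (Option Q), ∀ (D : Type) (vtt : Option Q) (w : ℕ → Set At × D)
      (u : Env D k (Option Q)) (i : ℕ) (θ : Fin k → D) (j : ℕ) (θ' : Fin k → D) (x : Option Q),
      aSat vtt w u ψ i θ j θ' x ↔ ∃ χ ∈ stateFmls A q, aSat vtt w u χ i θ j θ' x :=
  exists_finite_disjunction (((hδ.subset fun _ h => h.1).image _).insert _)
    (Set.insert_nonempty _ _)

/-- The formula describing all the moves of an automaton from a state. -/
noncomputable def stateFml {A : BRA At k Q} (hδ : A.δ.Finite) (q : Q) : Fml At k (Option Q) :=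
  (exists_stateFml hδ q).choose

theorem aSat_stateFml {A : BRA At k Q} (hδ : A.δ.Finite) {q : Q} {vtt : Option Q}
    {w : ℕ → Set At × D} {u : Env D k (Option Q)} {i θ j θ' x} :
    aSat vtt w u (stateFml hδ q) i θ j θ' x ↔
      ∃ χ ∈ stateFmls A q, aSat vtt w u χ i θ j θ' x :=
  (exists_stateFml hδ q).choose_spec D vtt w u i θ j θ' x

/-- The system of equations of an automaton. The variable `none` stands for truth; the redundant
disjunct `Fml.var (some q)` makes the right-hand sides pairwise distinct. -/
noncomputable def toEqSys {A : BRA At k Q} (hδ : A.δ.Finite) : EqSys At k (Option Q) where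
  σ
    | none => Fml.tt
    | some q => Fml.or (Fml.var (some q)) (stateFml hδ q)
  main := some A.q0
  omega := insert none (some '' A.acc)
  vtt := none

theorem toEqSys_WF {A : BRA At k Q} (hδ : A.δ.Finite) : (toEqSys hδ).WF := by
  refine ⟨Or.inl rfl, rfl, ?_⟩
  rintro (_ | q) - (_ | q') h
  · rfl
  · cases h
  · cases h
  · exact Fml.var.inj (Fml.or.inj h).1

theorem BSteps_of_mem_lfpEnv {A : BRA At k Q} (hδ : A.δ.Finite) {w : ℕ → Set At × D} {q : Q}
    {x : Option Q} {i j : ℕ} {θ θ' : Fin k → D}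
    (h : (i, θ, j, θ', x) ∈ lfpEnv (toEqSys hδ) w (some q)) :
    ∃ q', x = some q' ∧ BSteps A w (q, θ, i) (q', θ', j) := by
  refine lfpEnv_le (u := fun V => {t | ∀ q, V = some q → ∃ q', t.2.2.2.2 = some q' ∧
    BSteps A w (q, t.2.1, t.1) (q', t.2.2.2.1, t.2.2.1)}) ?_ _ h q rfl
  rintro _ ⟨i, θ, j, θ', x⟩ (h | ⟨-, i', θ₀, h⟩) q rfl
  · rcases h with h | h
    · exact h q rfl
    · obtain ⟨_, rfl | ⟨⟨p, g, R, p'⟩, ⟨hmem, rfl⟩, rfl⟩, h⟩ := (aSat_stateFml hδ).1 h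
      · exact h q rfl
      · cases g with
        | none =>
          by_cases hR : R = ∅
          · subst hR
            obtain ⟨q', hq', hsteps⟩ := h p' (by simp)
            exact ⟨q', hq', .head (.eps hmem) hsteps⟩
          · exact h p (by simp [hR])
        | some φ =>
          obtain ⟨-, hφ, h⟩ := h
          obtain ⟨q', hq', hsteps⟩ := h p' rfl
          exact ⟨q', hq', .head (.rule hmem hφ) hsteps⟩
  · simp only [Prod.mk.injEq] at h
    obtain ⟨rfl, rfl, rfl, rfl, rfl⟩ := h
    exact ⟨q, rfl, .refl⟩

theorem mem_lfpEnv_of_BSteps {A : BRA At k Q} (hδ : A.δ.Finite) {w : ℕ → Set At × D} {q q' : Q}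
    {i j : ℕ} {θ θ' : Fin k → D} (hq' : q' ∈ A.acc)
    (h : BSteps A w (q, θ, i) (q', θ', j)) :
    (i, θ, j, θ', some q') ∈ lfpEnv (toEqSys hδ) w (some q) := by
  suffices key : ∀ s, BSteps A w s (q', θ', j) →
      (s.2.2, s.2.1, j, θ', some q') ∈ lfpEnv (toEqSys hδ) w (some s.1) from key _ h
  intro s hs
  induction hs using Relation.ReflTransGen.head_induction_on with
  | refl => exact mem_lfpEnv_of_mem_omega (S := toEqSys hδ) (Or.inr ⟨q', hq', rfl⟩) j θ'
  | head hstep hrest ih =>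
    cases hstep with
    | rule hmem hφ =>
      exact mem_lfpEnv_of_aSat (S := toEqSys hδ) (Or.inr ((aSat_stateFml hδ).2
        ⟨_, Or.inr ⟨_, ⟨hmem, rfl⟩, rfl⟩, BSteps.le hrest, hφ, ih⟩))
    | eps hmem =>
      refine mem_lfpEnv_of_aSat (S := toEqSys hδ) (Or.inr ((aSat_stateFml hδ).2
        ⟨_, Or.inr ⟨_, ⟨hmem, rfl⟩, rfl⟩, ?_⟩))
      simpa [ruleFml, aSat] using ih

theorem sats_toEqSys_iff [Finite Q] {A : BRA At k Q} (hδ : A.δ.Finite) (dbot : D)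
    (w : ℕ → Set At × D) : sats (toEqSys hδ) dbot w ↔ accepts A dbot w := by
  rw [accepts_iff_exists_chain _ (Set.toFinite _)]
  constructor
  · rintro ⟨I, Θ, X, hI0, hΘ0, hX0, hI, homega, hmem⟩
    have hsome : ∀ n, ∃ q, X n = some q := by
      intro n
      induction n with
      | zero => exact ⟨_, hX0⟩
      | succ n ih =>
        obtain ⟨q, hq⟩ := ih
        exact (BSteps_of_mem_lfpEnv hδ (hq ▸ hmem n)).imp fun _ h => h.1
    choose Y hY using hsome
    refine ⟨I, Θ, Y, hI0, hΘ0, ?_, hI, fun n => ?_, fun n => ?_⟩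
    · exact Option.some.inj ((hY 0).symm.trans hX0)
    · simpa [toEqSys, hY] using homega n
    · obtain ⟨q', hq', hsteps⟩ := BSteps_of_mem_lfpEnv hδ (hY n ▸ hmem n)
      rw [hY, Option.some.injEq] at hq'
      exact hq' ▸ hsteps
  · rintro ⟨I, Θ, X, hI0, hΘ0, hX0, hI, hacc, hsteps⟩
    exact ⟨I, Θ, fun n => some (X n), hI0, hΘ0, congrArg some hX0, hI,
      fun n => Or.inr ⟨_, hacc n, rfl⟩, fun n => mem_lfpEnv_of_BSteps hδ (hacc n) (hsteps n)⟩

theorem exists_EqSys_of_BRA [Finite At] [Finite Q] (A : BRA At k Q) (dbot : D) :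
    ∃ (Var : Type) (_ : Finite Var) (S : EqSys At k Var), S.WF ∧
      {w : ℕ → Set At × D | sats S dbot w} = lang A dbot := by
  obtain ⟨T, hT, hstep⟩ := exists_finite_rules A
  let B : BRA At k Q := ⟨A.q0, T, A.acc⟩
  have hδ : B.δ.Finite := hT
  refine ⟨Option Q, inferInstance, toEqSys hδ, toEqSys_WF hδ, ?_⟩
  ext w
  refine (sats_toEqSys_iff hδ dbot w).trans ?_
  have hsteps : BSteps B w = BSteps A w := congrArg Relation.ReflTransGen (hstep D w)
  change accepts B dbot w ↔ accepts A dbot w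
  simp only [accepts, hsteps, B]

end AutomatonToSystem

end MuCal

/-- Expressive equivalence of μ↓dω-calculus and Büchi register automata:
a data language is recognized by some k-BRA iff it is {w | w ⊨ σ} for some system σ
of the μ↓dω-calculus with k registers. -/
theorem expressive_equivalence (At D : Type) [Finite At] [Countable D] [Infinite D]
    (dbot : D) (k : ℕ) (L : Set (ℕ → Set At × D)) :
    (∃ (Q : Type) (_ : Finite Q) (A : BRA At k Q), lang A dbot = L) ↔
    (∃ (Var : Type) (_ : Finite Var) (S : EqSys At k Var), S.WF ∧
      {w : ℕ → Set At × D | sats S dbot w} = L) := by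
  constructor
  · rintro ⟨Q, _, A, rfl⟩
    exact exists_EqSys_of_BRA A dbot
  · rintro ⟨Var, _, S, hS, rfl⟩
    exact exists_BRA_of_EqSys S hS.2.1 dbot
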